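/- If M is a convex plane curve, then for every λ ∈ ℝ the affine λ-equidistant E_λ(M) has no inflexion points, and the Centre Symmetry Set CSS(M) has no inflexion points. -/

import Mathlib

open Set Filter

noncomputable section

/-- The Euclidean plane. -/
abbrev E2 := EuclideanSpace ℝ (Fin 2)

/-- Planar cross product (determinant of two vectors). -/
def cross2 (u v : E2) : ℝ := u 0 * v 1 - u 1 * v 0

/-- Two vectors span parallel lines. -/
def VParallel (u v : E2) : Prop := cross2 u v = 0

/-- Signed curvature of a parametrized plane curve. -/
def curvature (f : ℝ → E2) (t : ℝ) : ℝ :=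
  cross2 (deriv f t) (deriv (deriv f) t) / ‖deriv f t‖ ^ 3

/-- A smooth regular parametrized plane curve. -/
structure PlaneCurve where
  γ : ℝ → E2
  smooth : ContDiff ℝ (⊤ : ℕ∞) γ
  regular : ∀ t, deriv γ t ≠ 0

/-- A closed curve: the parametrization is periodic (with period 1). -/
def PlaneCurve.IsClosedCurve (M : PlaneCurve) : Prop := Function.Periodic M.γ 1

/-- A convex curve: regular simple closed curve with nonvanishing signed curvature. -/
def PlaneCurve.IsConvexCurve (M : PlaneCurve) : Prop :=
  Function.Periodic M.γ 1 ∧ Set.InjOn M.γ (Set.Ico (0:ℝ) 1) ∧ ∀ t, curvature M.γ t ≠ 0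

/-- `s`, `t` are parameters of a parallel pair of the curve `M`. -/
def ParallelParams (M : PlaneCurve) (s t : ℝ) : Prop :=
  M.γ s ≠ M.γ t ∧ VParallel (deriv M.γ s) (deriv M.γ t)

/-- `a`, `b` is a parallel pair of points of `M`. -/
def ParallelPair (M : PlaneCurve) (a b : E2) : Prop :=
  ∃ s t : ℝ, M.γ s = a ∧ M.γ t = b ∧ ParallelParams M s t

/-- The affine `λ`-equidistant of the curve `M`. -/
def Eqd (M : PlaneCurve) (lam : ℝ) : Set E2 :=
  {x | ∃ a b : E2, ParallelPair M a b ∧ x = lam • a + (1 - lam) • b}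

/-- `p` is a `C^k`-regular point of the set `E`: near `p`, `E` is a `C^k`
one-dimensional manifold. -/
def IsCkRegularPoint (k : ℕ∞) (E : Set E2) (p : E2) : Prop :=
  p ∈ E ∧ ∃ U ∈ nhds p, ∃ f : ℝ → E2, ∃ I : Set ℝ, IsOpen I ∧
    ContDiffOn ℝ k f I ∧ (∀ t ∈ I, deriv f t ≠ 0) ∧ Set.InjOn f I ∧ E ∩ U = f '' I

/-- `p` is a regular point of `E`: a `C^k`-regular point for some `k ≥ 1`. -/
def IsRegularPoint (E : Set E2) (p : E2) : Prop :=
  ∃ k : ℕ, 1 ≤ k ∧ IsCkRegularPoint k E p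

/-- `p` is a singular point of `E`. -/
def IsSingularPoint (E : Set E2) (p : E2) : Prop :=
  p ∈ E ∧ ∀ k : ℕ, 1 ≤ k → ¬ IsCkRegularPoint k E p

/-- `M` is parametrized in opposite directions at the parameters `s` and `t`. -/
def OppositeDirections (M : PlaneCurve) (s t : ℝ) : Prop :=
  ∃ c : ℝ, c < 0 ∧ deriv M.γ t = c • deriv M.γ s

/-- `p` is an (ordinary) cusp point of the set `E`. -/
def IsCuspPoint (E : Set E2) (p : E2) : Prop :=
  p ∈ E ∧ ∃ f : ℝ → E2, ∃ t₀ : ℝ, ContDiff ℝ (⊤ : ℕ∞) f ∧ f t₀ = p ∧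
    deriv f t₀ = 0 ∧
    cross2 (deriv (deriv f) t₀) (deriv (deriv (deriv f)) t₀) ≠ 0 ∧
    ∃ U ∈ nhds p, ∃ ε > (0:ℝ), Set.InjOn f (Set.Ioo (t₀ - ε) (t₀ + ε)) ∧
      E ∩ U = f '' Set.Ioo (t₀ - ε) (t₀ + ε)

/-- The family of chords joining the parallel pairs `γ s`, `γ (T s)`. -/
def chordFamily (M : PlaneCurve) (T : ℝ → ℝ) : ℝ × ℝ → E2 :=
  fun su => M.γ su.1 + su.2 • (M.γ (T su.1) - M.γ su.1)

/-- The Centre Symmetry Set of `M`: the envelope (set of critical values of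
the chord families) of the lines joining parallel pairs of `M`. -/
def CSS (M : PlaneCurve) : Set E2 :=
  {p | ∃ T : ℝ → ℝ, ContDiff ℝ (⊤ : ℕ∞) T ∧ (∀ s, ParallelParams M s (T s)) ∧
    ∃ su : ℝ × ℝ, chordFamily M T su = p ∧
      ¬ Function.Surjective ⇑(fderiv ℝ (chordFamily M T) su)}

/-- The set `E` has a tangent line at `p` directed by `v` (at a regular point the
tangent direction, at a cusp point the limit of tangent directions). -/
def HasTangentLine (E : Set E2) (p v : E2) : Prop :=
  v ≠ 0 ∧ p ∈ E ∧ ∃ f : ℝ → E2, ∃ t₀ : ℝ, ContDiff ℝ (⊤ : ℕ∞) f ∧ f t₀ = p ∧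
    (∃ U ∈ nhds p, ∃ ε > (0:ℝ), E ∩ U = f '' Set.Ioo (t₀ - ε) (t₀ + ε)) ∧
    ((deriv f t₀ ≠ 0 ∧ VParallel v (deriv f t₀)) ∨
     (deriv f t₀ = 0 ∧ deriv (deriv f) t₀ ≠ 0 ∧ VParallel v (deriv (deriv f) t₀)))

/-- A parallel pair of a subset of the plane. -/
def SetParallelPair (E : Set E2) (a b : E2) : Prop :=
  a ≠ b ∧ ∃ v w : E2, HasTangentLine E a v ∧ HasTangentLine E b w ∧ VParallel v w

/-- The affine `λ`-equidistant of a subset of the plane. -/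
def EqdSet (E : Set E2) (lam : ℝ) : Set E2 :=
  {x | ∃ a b : E2, SetParallelPair E a b ∧ x = lam • a + (1 - lam) • b}

/-- The Centre Symmetry Set of a subset of the plane: the envelope of the lines
joining parallel pairs of `E`. -/
def CSSofSet (E : Set E2) : Set E2 :=
  {p | ∃ a b : ℝ → E2, ContDiff ℝ (⊤ : ℕ∞) a ∧ ContDiff ℝ (⊤ : ℕ∞) b ∧
    (∀ s : ℝ, SetParallelPair E (a s) (b s)) ∧
    ∃ su : ℝ × ℝ, a su.1 + su.2 • (b su.1 - a su.1) = p ∧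
      ¬ Function.Surjective
        ⇑(fderiv ℝ (fun q : ℝ × ℝ => a q.1 + q.2 • (b q.1 - a q.1)) su)}

/-- `p` is an inflexion point of the set `E`: the signed curvature of a local
regular parametrization of `E` vanishes at `p`. -/
def IsInflexionPoint (E : Set E2) (p : E2) : Prop :=
  p ∈ E ∧ ∃ f : ℝ → E2, ∃ t₀ : ℝ, ContDiff ℝ (⊤ : ℕ∞) f ∧ f t₀ = p ∧
    deriv f t₀ ≠ 0 ∧
    (∃ U ∈ nhds p, ∃ ε > (0:ℝ), E ∩ U = f '' Set.Ioo (t₀ - ε) (t₀ + ε)) ∧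
    curvature f t₀ = 0

/-- Rotation by 90 degrees. -/
def normalVec (u : E2) : E2 := (EuclideanSpace.equiv (Fin 2) ℝ).symm ![-(u 1), u 0]

/-- The center of curvature of the curve `f` at the parameter `s`. -/
def centerOfCurvature (f : ℝ → E2) (s : ℝ) : E2 :=
  f s + ((curvature f s)⁻¹ * ‖deriv f s‖⁻¹) • normalVec (deriv f s)

/-- The curves `f` and `g` are curved in the same side at the parallel pair
`f s`, `g t`. -/
def CurvedSameSide (f g : ℝ → E2) (s t : ℝ) : Prop :=
  0 < cross2 (deriv f s) (centerOfCurvature f s - f s) *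
      cross2 (deriv f s) (centerOfCurvature g t - g t)

/-- The curves `f` and `g` are curved in different sides at the parallel pair
`f s`, `g t`. -/
def CurvedDiffSides (f g : ℝ → E2) (s t : ℝ) : Prop :=
  cross2 (deriv f s) (centerOfCurvature f s - f s) *
      cross2 (deriv f s) (centerOfCurvature g t - g t) < 0

/-- An embedded smooth arc with endpoints, parametrized by `[0,1]`. -/
structure Arc where
  f : ℝ → E2
  smooth : ContDiff ℝ (⊤ : ℕ∞) f
  regular : ∀ t ∈ Set.Icc (0:ℝ) 1, deriv f t ≠ 0
  inj : Set.InjOn f (Set.Icc (0:ℝ) 1)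

/-- `u` is a tangent vector of the union `F₀ ∪ F₁` at the point `a`. -/
def TangentVecUnion (F₀ F₁ : Arc) (a u : E2) : Prop :=
  (∃ s ∈ Set.Icc (0:ℝ) 1, F₀.f s = a ∧ u = deriv F₀.f s) ∨
  (∃ s ∈ Set.Icc (0:ℝ) 1, F₁.f s = a ∧ u = deriv F₁.f s)

/-- A parallel pair of the union `F₀ ∪ F₁`. -/
def UnionParallelPair (F₀ F₁ : Arc) (a b : E2) : Prop :=
  a ≠ b ∧ ∃ u v : E2, TangentVecUnion F₀ F₁ a u ∧ TangentVecUnion F₀ F₁ b v ∧ VParallel u v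

/-- The affine `λ`-equidistant of the union `F₀ ∪ F₁`. -/
def EqdArcs (F₀ F₁ : Arc) (lam : ℝ) : Set E2 :=
  {x | ∃ a b : E2, UnionParallelPair F₀ F₁ a b ∧ x = lam • a + (1 - lam) • b}

/-- The rotation number of an arc parametrized by `[0,1]`: the total turning
divided by `2π`. -/
def rotationNumber (f : ℝ → E2) : ℝ :=
  (∫ t in (0:ℝ)..1, curvature f t * ‖deriv f t‖) / (2 * Real.pi)

/-- Derivative of the signed curvature with respect to arc length. -/
def curvatureDeriv (f : ℝ → E2) (s : ℝ) : ℝ :=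
  deriv (fun u => curvature f u) s / ‖deriv f s‖

/-- The unit tangent vector compatible with the orientation. -/
def unitTangent (f : ℝ → E2) (s : ℝ) : E2 := ‖deriv f s‖⁻¹ • deriv f s

open scoped Topology Real

section Cross

lemma cross2_smul_left (a : ℝ) (u v : E2) : cross2 (a • u) v = a * cross2 u v := by
  simp [cross2]; ring

lemma cross2_smul_right (a : ℝ) (u v : E2) : cross2 u (a • v) = a * cross2 u v := by
  simp [cross2]; ring

lemma cross2_self (u : E2) : cross2 u u = 0 := by
  simp [cross2]; ring

lemma cross2_swap (u v : E2) : cross2 u v = -cross2 v u := by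
  simp [cross2]; ring

lemma continuous_cross2 : Continuous fun p : E2 × E2 => cross2 p.1 p.2 := by
  unfold cross2
  fun_prop

lemma tendsto_cross2 {α : Type*} {l : Filter α} {u v : α → E2} {a b : E2}
    (hu : Tendsto u l (𝓝 a)) (hv : Tendsto v l (𝓝 b)) :
    Tendsto (fun x => cross2 (u x) (v x)) l (𝓝 (cross2 a b)) :=
  (continuous_cross2.tendsto (a, b)).comp (hu.prodMk_nhds hv)

lemma hasDerivAt_E2_iff {f : ℝ → E2} {v : E2} {t : ℝ} :
    HasDerivAt f v t ↔
      HasDerivAt (fun s => f s 0) (v 0) t ∧ HasDerivAt (fun s => f s 1) (v 1) t := by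
  have key : HasDerivAt f v t ↔ ∀ i, HasDerivAt (fun s => f s i) (v i) t := by
    rw [← hasDerivWithinAt_univ, hasDerivWithinAt_iff_hasFDerivWithinAt,
      hasFDerivWithinAt_euclidean]
    refine forall_congr' fun i => ?_
    rw [← hasDerivWithinAt_univ, hasDerivWithinAt_iff_hasFDerivWithinAt]
    have : (PiLp.proj 2 (fun _ => ℝ) i).comp (ContinuousLinearMap.toSpanSingleton ℝ v) =
        ContinuousLinearMap.toSpanSingleton ℝ (v i) := by
      ext; simp
    rw [this]
  rw [key, Fin.forall_fin_two]

lemma hasDerivAt_cross2 {f g : ℝ → E2} {u v : E2} {t : ℝ}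
    (hf : HasDerivAt f u t) (hg : HasDerivAt g v t) :
    HasDerivAt (fun s => cross2 (f s) (g s)) (cross2 u (g t) + cross2 (f t) v) t := by
  obtain ⟨f0, f1⟩ := hasDerivAt_E2_iff.1 hf
  obtain ⟨g0, g1⟩ := hasDerivAt_E2_iff.1 hg
  refine ((f0.mul g1).sub (f1.mul g0)).congr_deriv ?_
  simp only [cross2]
  ring

end Cross

section Accumulation

/-- An uncountable subset of a second countable space has an accumulation point in itself. -/
lemma exists_accPt_of_not_countable {α : Type*} [TopologicalSpace α] [SecondCountableTopology α]
    {X : Set α} (hX : ¬ X.Countable) : ∃ x ∈ X, AccPt x (𝓟 X) := by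
  by_contra! h
  have : DiscreteTopology X := discreteTopology_of_noAccPts h
  exact hX (Set.countable_coe_iff.1 countable_of_Lindelof_of_discrete)

/-- An uncountable subset of a second countable space has a point which is an accumulation point
of accumulation points of the set. -/
lemma exists_accPt_accPt_of_not_countable {α : Type*} [TopologicalSpace α]
    [SecondCountableTopology α] {X : Set α} (hX : ¬ X.Countable) :
    ∃ x ∈ X, AccPt x (𝓟 X) ∧ AccPt x (𝓟 {y ∈ X | AccPt y (𝓟 X)}) := by
  by_cases hY : {y ∈ X | AccPt y (𝓟 X)}.Countable
  · have hZ : ¬ {y ∈ X | ¬ AccPt y (𝓟 X)}.Countable := by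
      intro hZ
      refine hX ((hY.union hZ).mono fun y hy => ?_)
      by_cases h : AccPt y (𝓟 X)
      · exact Or.inl ⟨hy, h⟩
      · exact Or.inr ⟨hy, h⟩
    obtain ⟨x, hx, hacc⟩ := exists_accPt_of_not_countable hZ
    exact absurd (hacc.mono (principal_mono.2 fun y hy => hy.1)) hx.2
  · obtain ⟨x, hx, hacc⟩ := exists_accPt_of_not_countable hY
    exact ⟨x, hx.1, hx.2, hacc⟩

/-- Two curves meeting along a filter converging to a common regular point are tangent there. -/
lemma tangent_of_tendsto {f g : ℝ → E2} {v w : E2} {t θ : ℝ} {F : Filter (ℝ × ℝ)} [F.NeBot]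
    (hF : F ≤ 𝓝 (t, θ)) (hne : ∀ᶠ x in F, x ≠ (t, θ)) (heq : ∀ᶠ x in F, f x.1 = g x.2)
    (h0 : f t = g θ) (hf : HasDerivAt f v t) (hg : HasDerivAt g w θ) (hv : v ≠ 0) (hw : w ≠ 0) :
    ∃ r : ℝ, v = r • w ∧ Tendsto (fun x : ℝ × ℝ => (x.2 - θ) / (x.1 - t)) F (𝓝 r) ∧
      Tendsto Prod.fst F (𝓝[≠] t) ∧ Tendsto Prod.snd F (𝓝[≠] θ) := by
  have h1 : Tendsto Prod.fst F (𝓝 t) := (continuous_fst.tendsto (t, θ)).mono_left hF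
  have h2 : Tendsto Prod.snd F (𝓝 θ) := (continuous_snd.tendsto (t, θ)).mono_left hF
  have hfne : ∀ᶠ s in 𝓝 t, s ≠ t → f s ≠ f t := eventually_nhdsWithin_iff.1 (hf.eventually_ne hv)
  have hgne : ∀ᶠ s in 𝓝 θ, s ≠ θ → g s ≠ g θ := eventually_nhdsWithin_iff.1 (hg.eventually_ne hw)
  have hboth : ∀ᶠ x in F, x.1 ≠ t ∧ x.2 ≠ θ := by
    filter_upwards [hne, heq, h1.eventually hfne, h2.eventually hgne] with x hx hxe hxf hxg
    constructor
    · intro h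
      by_cases h' : x.2 = θ
      · exact hx (Prod.ext h h')
      · exact hxg h' (by rw [← hxe, h, h0])
    · intro h
      by_cases h' : x.1 = t
      · exact hx (Prod.ext h' h)
      · exact hxf h' (by rw [hxe, h, h0])
  have h1' : Tendsto Prod.fst F (𝓝[≠] t) :=
    tendsto_nhdsWithin_iff.2 ⟨h1, hboth.mono fun x hx => hx.1⟩
  have h2' : Tendsto Prod.snd F (𝓝[≠] θ) :=
    tendsto_nhdsWithin_iff.2 ⟨h2, hboth.mono fun x hx => hx.2⟩
  have sf : Tendsto (fun x : ℝ × ℝ => slope f t x.1) F (𝓝 v) := hf.tendsto_slope.comp h1'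
  have sg : Tendsto (fun x : ℝ × ℝ => slope g θ x.2) F (𝓝 w) := hg.tendsto_slope.comp h2'
  have hslope : ∀ᶠ x in F, slope f t x.1 = ((x.2 - θ) / (x.1 - t)) • slope g θ x.2 := by
    filter_upwards [hboth, heq] with x hx hxe
    have := sub_ne_zero.2 hx.2
    rw [slope_def_module, slope_def_module, hxe, h0, smul_smul]
    congr 1
    field_simp
  have hww : inner ℝ w w ≠ 0 := inner_self_ne_zero.2 hw
  have ig : Tendsto (fun x : ℝ × ℝ => inner ℝ w (slope g θ x.2)) F (𝓝 (inner ℝ w w)) :=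
    tendsto_const_nhds.inner sg
  have if' : Tendsto (fun x : ℝ × ℝ => inner ℝ w (slope f t x.1)) F (𝓝 (inner ℝ w v)) :=
    tendsto_const_nhds.inner sf
  have hr : Tendsto (fun x : ℝ × ℝ => (x.2 - θ) / (x.1 - t)) F
      (𝓝 (inner ℝ w v / inner ℝ w w)) := by
    refine (if'.div ig hww).congr' ?_
    filter_upwards [hslope, ig.eventually_ne hww] with x hx hx'
    simp only [Pi.div_apply]
    rw [hx, inner_smul_right]
    field_simp
  refine ⟨_, ?_, hr, h1', h2'⟩
  exact tendsto_nhds_unique sf ((hr.smul sg).congr' (hslope.mono fun x hx => hx.symm))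

/-- If `f` touches the front `g` (with `g' = ρ e`) at an accumulation point of tangency points, the
curvature of `f` is that of `g`. -/
lemma curvature_relation {f f' g e : ℝ → E2} {ρ : ℝ → ℝ} {f'' e' : E2} {t θ : ℝ}
    {F : Filter (ℝ × ℝ)} [F.NeBot] (hF : F ≤ 𝓝 (t, θ)) (hne : ∀ᶠ x in F, x ≠ (t, θ))
    (heq : ∀ᶠ x in F, f x.1 = g x.2) (h0 : f t = g θ)
    (hf : HasDerivAt f (f' t) t) (hf' : HasDerivAt f' f'' t)
    (hg : HasDerivAt g (ρ θ • e θ) θ) (he : HasDerivAt e e' θ)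
    (hv : f' t ≠ 0) (hρ : ρ θ ≠ 0) (he0 : e θ ≠ 0)
    (htan : ∀ᶠ x in F, cross2 (f' x.1) (e x.2) = 0) :
    |cross2 (f' t) f''| * (|ρ θ| * ‖e θ‖ ^ 3) = ‖f' t‖ ^ 3 * |cross2 (e θ) e'| := by
  obtain ⟨r, hr, hlim, h1, h2⟩ := tangent_of_tendsto hF hne heq h0 hf hg hv (smul_ne_zero hρ he0)
  have sf : Tendsto (fun x : ℝ × ℝ => slope f' t x.1) F (𝓝 f'') := hf'.tendsto_slope.comp h1
  have se : Tendsto (fun x : ℝ × ℝ => slope e θ x.2) F (𝓝 e') := he.tendsto_slope.comp h2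
  have ce : Tendsto (fun x : ℝ × ℝ => e x.2) F (𝓝 (e θ)) :=
    he.continuousAt.tendsto.comp (h2.mono_right nhdsWithin_le_nhds)
  have hzero : cross2 (f' t) (e θ) = 0 := by
    rw [hr, smul_smul, cross2_smul_left, cross2_self, mul_zero]
  have L : Tendsto (fun x : ℝ × ℝ => cross2 (slope f' t x.1) (e x.2) +
      (x.2 - θ) / (x.1 - t) * cross2 (f' t) (slope e θ x.2)) F
      (𝓝 (cross2 f'' (e θ) + r * cross2 (f' t) e')) :=
    (tendsto_cross2 sf ce).add (hlim.mul (tendsto_cross2 tendsto_const_nhds se))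
  have Z : cross2 f'' (e θ) + r * cross2 (f' t) e' = 0 := by
    refine tendsto_nhds_unique L (tendsto_const_nhds.congr' ?_)
    filter_upwards [htan, (tendsto_nhdsWithin_iff.1 h1).2, (tendsto_nhdsWithin_iff.1 h2).2]
      with x hx hx1 hx2
    have e1 := sub_ne_zero.2 (show x.1 ≠ t from hx1)
    have e2 := sub_ne_zero.2 (show x.2 ≠ θ from hx2)
    rw [slope_def_module, slope_def_module, cross2_smul_left, cross2_smul_right]
    field_simp
    simp only [cross2, PiLp.sub_apply] at hx hzero ⊢
    linear_combination hzero - hx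
  set κ := r * ρ θ with hκ
  have hfe : f' t = κ • e θ := by rw [hr, smul_smul]
  have hnorm : ‖f' t‖ = |κ| * ‖e θ‖ := by rw [hfe, norm_smul, Real.norm_eq_abs]
  have hrel : cross2 (f' t) f'' * ρ θ = κ ^ 3 * cross2 (e θ) e' := by
    rw [cross2_swap f'', hfe, cross2_smul_left] at Z
    rw [hfe, cross2_smul_left]
    linear_combination (-(κ * ρ θ)) * Z - κ ^ 2 * cross2 (e θ) e' * hκ
  have := congrArg abs hrel
  rw [abs_mul, abs_mul, abs_pow] at this
  rw [hnorm, mul_pow, ← mul_assoc, this]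
  ring

/-- A regular curve traced inside countably many fronts whose curvature is bounded away from zero
has no inflexion. -/
lemma cross2_ne_zero_of_mem_fronts {ι : Type*} [Countable ι] {g e e' : ι → ℝ → E2}
    {ρ : ι → ℝ → ℝ} {c : ℝ} (hc : 0 < c)
    (hg : ∀ i φ, HasDerivAt (g i) (ρ i φ • e i φ) φ)
    (he : ∀ i φ, HasDerivAt (e i) (e' i φ) φ)
    (hcross : ∀ i φ, cross2 (e i φ) (e' i φ) ≠ 0)
    (hbound : ∀ i φ, c * (|ρ i φ| * ‖e i φ‖ ^ 3) ≤ |cross2 (e i φ) (e' i φ)|)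
    {f f' f'' : ℝ → E2} (hf : ∀ t, HasDerivAt f (f' t) t) (hf' : ∀ t, HasDerivAt f' (f'' t) t)
    (hf'' : Continuous f'') {t₀ : ℝ} (h0 : f' t₀ ≠ 0)
    (hmem : ∀ᶠ t in 𝓝 t₀, ∃ i φ, f t = g i φ) :
    cross2 (f' t₀) (f'' t₀) ≠ 0 := by
  intro hzero
  have cf' : Continuous f' := continuous_iff_continuousAt.2 fun t => (hf' t).continuousAt
  have cf : Continuous f := continuous_iff_continuousAt.2 fun t => (hf t).continuousAt
  have hsmall : ∀ᶠ t in 𝓝 t₀, |cross2 (f' t) (f'' t)| < c * ‖f' t‖ ^ 3 := by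
    refine ContinuousAt.eventually_lt ?_ ?_ ?_
    · exact (continuous_abs.comp (continuous_cross2.comp (cf'.prodMk hf''))).continuousAt
    · fun_prop
    · rw [hzero, abs_zero]
      have := norm_pos_iff.2 h0
      positivity
  have hreg : ∀ᶠ t in 𝓝 t₀, f' t ≠ 0 := cf'.continuousAt.eventually_ne h0
  obtain ⟨δ, hδ, hball⟩ := Metric.eventually_nhds_iff_ball.1 (hmem.and (hsmall.and hreg))
  set J := Metric.ball t₀ δ with hJ
  let l : E2 → ℝ := fun x => inner ℝ (f' t₀) x
  have hl : ∀ {h : ℝ → E2} {v : E2} {s : ℝ}, HasDerivAt h v s →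
      HasDerivAt (fun x => l (h x)) (l v) s := fun {h v s} hh => by
    simpa [l] using (hasDerivAt_const s (f' t₀)).inner ℝ hh
  let X : ι → Set (ℝ × ℝ) := fun i => {x | x.1 ∈ J ∧ f x.1 = g i x.2 ∧ ρ i x.2 ≠ 0}
  have hX : ∃ i, ¬ (X i).Countable := by
    by_contra! hall
    have hcov : (fun t => l (f t)) '' J ⊆
        (⋃ i, (fun φ => l (g i φ)) '' {φ | ρ i φ = 0}) ∪
          ⋃ i, (fun x : ℝ × ℝ => l (f x.1)) '' X i := by
      rintro _ ⟨t, ht, rfl⟩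
      obtain ⟨i, φ, hi⟩ := (hball t ht).1
      by_cases hρ : ρ i φ = 0
      · exact Or.inl (mem_iUnion.2 ⟨i, φ, hρ, by simp only [hi]⟩)
      · exact Or.inr (mem_iUnion.2 ⟨i, (t, φ), ⟨ht, hi, hρ⟩, rfl⟩)
    have hnull : MeasureTheory.volume ((fun t => l (f t)) '' J) = 0 := by
      refine MeasureTheory.measure_mono_null hcov (MeasureTheory.measure_union_null ?_ ?_)
      · refine MeasureTheory.measure_iUnion_null fun i => ?_
        refine MeasureTheory.addHaar_image_eq_zero_of_det_fderivWithin_eq_zero _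
          (f' := fun _ => 0) (fun φ hφ => ?_) (fun φ hφ => by simp)
        have := hl (hg i φ)
        rw [show ρ i φ = 0 from hφ] at this
        have h2 := (this.hasFDerivAt).hasFDerivWithinAt (s := {φ | ρ i φ = 0})
        simpa [l] using h2
      · exact (Set.countable_iUnion fun i => (hall i).image _).measure_zero _
    have hne := (hl (hf t₀)).eventually_ne (c := l (f t₀))
      (by simpa [l] using h0)
    obtain ⟨t₁, ht₁, ht₁J⟩ := (hne.and (mem_nhdsWithin_of_mem_nhds (Metric.ball_mem_nhds t₀ hδ))).exists
    have hconn : ((fun t => l (f t)) '' J).OrdConnected := by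
      refine IsPreconnected.ordConnected (IsPreconnected.image ?_ _ ?_)
      · exact (convex_ball t₀ δ).isPreconnected
      · exact (continuous_iff_continuousAt.2 fun t => (hl (hf t)).continuousAt).continuousOn
    have hsub := hconn.uIcc_subset (mem_image_of_mem _ (Metric.mem_ball_self hδ))
      (mem_image_of_mem _ ht₁J)
    have := MeasureTheory.measure_mono_null hsub hnull
    rw [Set.uIcc, Real.volume_Icc, ENNReal.ofReal_eq_zero, sub_nonpos] at this
    exact ht₁ (by
      have h1 := inf_le_sup.antisymm this
      exact (inf_eq_sup.1 h1).symm)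
  obtain ⟨i, hi⟩ := hX
  have he0 : ∀ φ, e i φ ≠ 0 := fun φ h => hcross i φ (by rw [h]; simp [cross2])
  obtain ⟨x, hx, hacc, hacc'⟩ := exists_accPt_accPt_of_not_countable hi
  have htan : ∀ y ∈ X i, AccPt y (𝓟 (X i)) → cross2 (f' y.1) (e i y.2) = 0 := by
    intro y hy hyacc
    have : (𝓝[X i \ {y}] y).NeBot := accPt_principal_iff_nhdsWithin.1 hyacc
    obtain ⟨r, hr, -⟩ := tangent_of_tendsto (F := 𝓝[X i \ {y}] y) (t := y.1) (θ := y.2)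
      nhdsWithin_le_nhds
      (eventually_mem_nhdsWithin.mono fun z hz => hz.2)
      (eventually_mem_nhdsWithin.mono fun z hz => hz.1.2.1) hy.2.1 (hf y.1) (hg i y.2)
      (hball _ hy.1).2.2 (smul_ne_zero hy.2.2 (he0 _))
    rw [hr, smul_smul, cross2_smul_left, cross2_self, mul_zero]
  have : (𝓝[{y ∈ X i | AccPt y (𝓟 (X i))} \ {x}] x).NeBot := accPt_principal_iff_nhdsWithin.1 hacc'
  have key := curvature_relation (F := 𝓝[{y ∈ X i | AccPt y (𝓟 (X i))} \ {x}] x)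
      (t := x.1) (θ := x.2) (ρ := ρ i) nhdsWithin_le_nhds
      (eventually_mem_nhdsWithin.mono fun z hz => hz.2)
      (eventually_mem_nhdsWithin.mono fun z hz => hz.1.1.2.1) hx.2.1 (hf x.1) (hf' x.1)
      (hg i x.2) (he i x.2) (hball _ hx.1).2.2 hx.2.2 (he0 _)
      (eventually_mem_nhdsWithin.mono fun z hz => htan z hz.1.1 hz.1.2)
  have hlt := (hball _ hx.1).2.1
  have hpos : 0 < |ρ i x.2| * ‖e i x.2‖ ^ 3 :=
    mul_pos (abs_pos.2 hx.2.2) (pow_pos (norm_pos_iff.2 (he0 _)) 3)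
  have h3 := mul_lt_mul_of_pos_right hlt hpos
  have h4 := mul_le_mul_of_nonneg_left (hbound i x.2) (pow_nonneg (norm_nonneg (f' x.1)) 3)
  rw [key] at h3
  linarith

end Accumulation

section Convexity

/-- The unit vector of angle `φ`. -/
def unitVec (φ : ℝ) : E2 := !₂[Real.cos φ, Real.sin φ]

@[simp] lemma unitVec_zero (φ : ℝ) : unitVec φ 0 = Real.cos φ := rfl

@[simp] lemma unitVec_one (φ : ℝ) : unitVec φ 1 = Real.sin φ := rfl

/-- The derivative of `unitVec`. -/
def unitVec' (φ : ℝ) : E2 := !₂[-Real.sin φ, Real.cos φ]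

@[simp] lemma unitVec'_zero (φ : ℝ) : unitVec' φ 0 = -Real.sin φ := rfl

@[simp] lemma unitVec'_one (φ : ℝ) : unitVec' φ 1 = Real.cos φ := rfl

lemma hasDerivAt_unitVec (φ : ℝ) : HasDerivAt unitVec (unitVec' φ) φ :=
  hasDerivAt_E2_iff.2 ⟨Real.hasDerivAt_cos φ, Real.hasDerivAt_sin φ⟩

lemma cross2_unitVec (α β : ℝ) : cross2 (unitVec α) (unitVec β) = Real.sin (β - α) := by
  simp [cross2, Real.sin_sub]; ring

lemma cross2_unitVec_unitVec' (φ : ℝ) : cross2 (unitVec φ) (unitVec' φ) = 1 := by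
  simp only [cross2, unitVec_zero, unitVec_one, unitVec'_zero, unitVec'_one]
  linear_combination Real.sin_sq_add_cos_sq φ

lemma norm_unitVec (φ : ℝ) : ‖unitVec φ‖ = 1 := by
  simp [EuclideanSpace.norm_eq, Real.cos_sq_add_sin_sq]

lemma unitVec_add_int_mul_pi (φ : ℝ) (k : ℤ) :
    unitVec (φ + k * π) = Real.cos (k * π) • unitVec φ := by
  ext i
  fin_cases i <;> simp [Real.cos_add, Real.sin_add, Real.sin_int_mul_pi] <;> ring

/-- A convex arc turning by `2π` whose end lies ahead of its start on a common tangent line has a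
self-intersection. -/
lemma exists_self_intersection {x h r : ℝ → ℝ} (hr : ∀ τ, 0 < r τ)
    (hx : ∀ τ, HasDerivAt x (r τ * Real.cos τ) τ) (hh : ∀ τ, HasDerivAt h (r τ * Real.sin τ) τ)
    (hclose : h (2 * π) = h 0) (hahead : x 0 < x (2 * π)) :
    ∃ a b, 0 < b - a ∧ b - a < 2 * π ∧ x a = x b ∧ h a = h b := by
  have hpi := Real.pi_pos
  have cx : Continuous x := continuous_iff_continuousAt.2 fun t => (hx t).continuousAt
  have ch : Continuous h := continuous_iff_continuousAt.2 fun t => (hh t).continuousAt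
  have hup : StrictMonoOn h (Icc 0 π) := by
    refine strictMonoOn_of_deriv_pos (convex_Icc _ _) ch.continuousOn fun τ hτ => ?_
    rw [interior_Icc] at hτ
    rw [(hh τ).deriv]
    exact mul_pos (hr τ) (Real.sin_pos_of_pos_of_lt_pi hτ.1 hτ.2)
  have hdown : StrictAntiOn h (Icc π (2 * π)) := by
    refine strictAntiOn_of_deriv_neg (convex_Icc _ _) ch.continuousOn fun τ hτ => ?_
    rw [interior_Icc] at hτ
    rw [(hh τ).deriv]
    have : 0 < Real.sin (τ - π) :=
      Real.sin_pos_of_pos_of_lt_pi (by linarith [hτ.1]) (by linarith [hτ.2])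
    rw [Real.sin_sub_pi] at this
    exact mul_neg_of_pos_of_neg (hr τ) (by linarith)
  have hleft : StrictAntiOn x (Icc (π / 2) (π + π / 2)) := by
    refine strictAntiOn_of_deriv_neg (convex_Icc _ _) cx.continuousOn fun τ hτ => ?_
    rw [interior_Icc] at hτ
    rw [(hx τ).deriv]
    exact mul_neg_of_pos_of_neg (hr τ)
      (Real.cos_neg_of_pi_div_two_lt_of_lt hτ.1 (by linarith [hτ.2]))
  -- a level at which the ascending branch is to the right of the descending one
  obtain ⟨a', b', ha', hb', hab', hxab'⟩ : ∃ a' b', a' ∈ Icc 0 π ∧ b' ∈ Icc π (2 * π) ∧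
      h a' = h b' ∧ x b' < x a' := by
    rcases le_total (h (π + π / 2)) (h (π / 2)) with hle | hle
    · obtain ⟨b, hb, hbe⟩ := intermediate_value_Icc' (show π ≤ π + π / 2 by linarith)
        ch.continuousOn ⟨hle, hup.monotoneOn (by constructor <;> linarith)
          (by constructor <;> linarith) (by linarith)⟩
      exact ⟨π / 2, b, by constructor <;> linarith, ⟨hb.1, by linarith [hb.2]⟩, hbe.symm,
        hleft (by constructor <;> linarith) ⟨by linarith [hb.1], hb.2⟩ (by linarith [hb.1])⟩
    · obtain ⟨a, ha, hae⟩ := intermediate_value_Icc (show π / 2 ≤ π by linarith)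
        ch.continuousOn ⟨hle, hdown.antitoneOn (by constructor <;> linarith)
          (by constructor <;> linarith) (by linarith)⟩
      exact ⟨a, π + π / 2, ⟨by linarith [ha.1], ha.2⟩, by constructor <;> linarith, hae,
        hleft ⟨ha.1, by linarith [ha.2]⟩ (by constructor <;> linarith) (by linarith [ha.2])⟩
  let R : Set (ℝ × ℝ) := (Icc 0 a' ×ˢ Icc π (2 * π)) ∩ {p | h p.1 = h p.2}
  have hR : IsCompact R := (isCompact_Icc.prod isCompact_Icc).inter_right
    (isClosed_eq (by fun_prop) (by fun_prop))
  have hA : IsClosed (Prod.fst '' (R ∩ {p | x p.1 ≤ x p.2})) :=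
    ((hR.inter_right (isClosed_le (by fun_prop) (by fun_prop))).image continuous_fst).isClosed
  have hB : IsClosed (Prod.fst '' (R ∩ {p | x p.2 ≤ x p.1})) :=
    ((hR.inter_right (isClosed_le (by fun_prop) (by fun_prop))).image continuous_fst).isClosed
  have hcov : Icc 0 a' ⊆ Prod.fst '' (R ∩ {p | x p.1 ≤ x p.2}) ∪
      Prod.fst '' (R ∩ {p | x p.2 ≤ x p.1}) := by
    intro a ha
    have haπ : a ∈ Icc 0 π := ⟨ha.1, ha.2.trans ha'.2⟩
    obtain ⟨b, hb, hbe⟩ := intermediate_value_Icc' (show π ≤ 2 * π by linarith) ch.continuousOn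
      (show h a ∈ Icc (h (2 * π)) (h π) from
        ⟨hclose ▸ hup.monotoneOn (by constructor <;> linarith) haπ ha.1,
          hup.monotoneOn haπ (by constructor <;> linarith) haπ.2⟩)
    rcases le_total (x a) (x b) with hle | hle
    · exact Or.inl ⟨(a, b), ⟨⟨⟨ha, hb⟩, hbe.symm⟩, hle⟩, rfl⟩
    · exact Or.inr ⟨(a, b), ⟨⟨⟨ha, hb⟩, hbe.symm⟩, hle⟩, rfl⟩
  obtain ⟨a, ha, ⟨⟨a₁, b⟩, ⟨⟨⟨-, hb⟩, hab⟩, hxab⟩, rfl⟩,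
      ⟨⟨a₂, b₂⟩, ⟨⟨⟨-, hb₂⟩, hab₂⟩, hxab₂⟩, heq⟩⟩ :=
    isPreconnected_closed_iff.1 isPreconnected_Icc _ _ hA hB hcov
      ⟨0, ⟨le_rfl, ha'.1⟩, (0, 2 * π), ⟨⟨⟨⟨le_rfl, ha'.1⟩, by linarith, le_rfl⟩, hclose.symm⟩,
        hahead.le⟩, rfl⟩
      ⟨a', ⟨ha'.1, le_rfl⟩, (a', b'), ⟨⟨⟨⟨ha'.1, le_rfl⟩, hb'⟩, hab'⟩, hxab'.le⟩, rfl⟩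
  simp only [mem_ofPred_eq] at hab hab₂ hxab hxab₂ heq ha hb hb₂
  subst heq
  obtain rfl : b₂ = b := hdown.injOn hb₂ hb (hab₂.symm.trans hab)
  have hxe : x a₂ = x b₂ := le_antisymm hxab hxab₂
  refine ⟨a₂, b₂, ?_, ?_, hxe, hab⟩
  · by_contra hcon
    have h1 : a₂ = π := by linarith [ha.2, ha'.2, hb.1]
    have h2 : a' = π := by linarith [ha.2, ha'.2]
    have h3 : b' = π := hdown.injOn hb' ⟨le_rfl, by linarith⟩ (by rw [← hab', h2])
    rw [h2, h3] at hxab'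
    exact lt_irrefl _ hxab'
  · by_contra hcon
    have h1 : a₂ = 0 := by linarith [ha.1, hb.2]
    have h2 : b₂ = 2 * π := by linarith [ha.1, hb.2]
    rw [h1, h2] at hxe
    exact hahead.ne hxe

/-- A closed curve parametrized by its tangent angle, with positive radius of curvature, which is
simple, closes up after one turn. -/
lemma periodic_two_pi_of_simple {c : ℝ → E2} {ρ : ℝ → ℝ} {P : ℝ} (hρ : ∀ φ, 0 < ρ φ)
    (hc : ∀ φ, HasDerivAt c (ρ φ • unitVec φ) φ) (hP : P ≠ 0) (hper : Function.Periodic c P)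
    (hinj : ∀ a b, c a = c b → ∃ k : ℤ, b - a = k * P) : Function.Periodic c (2 * π) := by
  have hpi := Real.pi_pos
  obtain ⟨n, hn⟩ : ∃ n : ℤ, P = n * (2 * π) := by
    have h1 : HasDerivAt c (ρ (0 + P) • unitVec (0 + P)) 0 := by
      have := (hc (0 + P)).comp_add_const 0 P
      rwa [show (fun x => c (x + P)) = c from funext hper] at this
    have h2 := h1.unique (hc 0)
    have hcos := congrFun (congrArg WithLp.ofLp h2) 0
    have hsin := congrFun (congrArg WithLp.ofLp h2) 1
    simp only [zero_add, PiLp.smul_apply, smul_eq_mul, unitVec_zero, unitVec_one, Real.cos_zero,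
      Real.sin_zero, mul_one, mul_zero] at hcos hsin
    have hsinP : Real.sin P = 0 := (mul_eq_zero.1 hsin).resolve_left (hρ P).ne'
    have hcosP : 0 < Real.cos P := pos_of_mul_pos_right (hcos ▸ hρ 0) (hρ P).le
    have hcos1 : Real.cos P = 1 := by nlinarith [Real.sin_sq_add_cos_sq P]
    obtain ⟨n, hn⟩ := (Real.cos_eq_one_iff P).1 hcos1
    exact ⟨n, hn.symm⟩
  by_contra hnot
  have hD : ∀ φ, c (φ + 2 * π) - c φ ≠ 0 := by
    intro φ h
    obtain ⟨k, hk⟩ := hinj _ _ (sub_eq_zero.1 h).symm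
    refine hnot ?_
    rw [show 2 * π = k * P by linarith]
    exact hper.int_mul k
  let q : ℝ → ℝ := fun φ => cross2 (c (φ + 2 * π) - c φ) (unitVec φ)
  have hq : ∀ φ, HasDerivAt q (cross2 (c (φ + 2 * π) - c φ) (unitVec' φ)) φ := by
    intro φ
    have h1 := (hc (φ + 2 * π)).comp_add_const φ (2 * π)
    refine (hasDerivAt_cross2 (h1.sub (hc φ)) (hasDerivAt_unitVec φ)).congr_deriv ?_
    simp only [cross2, PiLp.sub_apply, PiLp.smul_apply, smul_eq_mul, unitVec_zero, unitVec_one,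
      Real.cos_add_two_pi, Real.sin_add_two_pi, Pi.sub_apply]
    ring
  have cq : Continuous q := continuous_iff_continuousAt.2 fun t => (hq t).continuousAt
  have hneg : ∀ φ, q φ = 0 → cross2 (c (φ + 2 * π) - c φ) (unitVec' φ) < 0 := by
    intro φ hφ
    by_contra! hge
    rcases hge.eq_or_lt with h0 | hlt
    · refine hD φ ?_
      simp only [q, cross2, unitVec_zero, unitVec_one, unitVec'_zero, unitVec'_one] at hφ h0
      have hs := Real.sin_sq_add_cos_sq φ
      ext i
      fin_cases i
      · simp only [Fin.zero_eta, PiLp.zero_apply]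
        linear_combination Real.sin φ * hφ - Real.cos φ * h0 -
          (c (φ + 2 * π) - c φ) 0 * hs
      · simp only [Fin.mk_one, PiLp.zero_apply]
        linear_combination -Real.cos φ * hφ - Real.sin φ * h0 -
          (c (φ + 2 * π) - c φ) 1 * hs
    · have hsub : ∀ τ, HasDerivAt (fun τ => c (τ + φ)) (ρ (τ + φ) • unitVec (τ + φ)) τ :=
        fun τ => (hc (τ + φ)).comp_add_const τ φ
      have hs : ∀ τ, Real.cos τ = Real.cos (τ + φ) * Real.cos φ + Real.sin (τ + φ) * Real.sin φ ∧
          Real.sin τ = Real.sin (τ + φ) * Real.cos φ - Real.cos (τ + φ) * Real.sin φ := by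
        intro τ
        rw [← Real.cos_sub, ← Real.sin_sub, add_sub_cancel_right]
        exact ⟨rfl, rfl⟩
      obtain ⟨a, b, hab, hab', hx, hh⟩ := exists_self_intersection
        (x := fun τ => cross2 (c (τ + φ)) (unitVec' φ))
        (h := fun τ => -cross2 (c (τ + φ)) (unitVec φ)) (r := fun τ => ρ (τ + φ))
        (fun τ => hρ _)
        (fun τ => by
          refine (hasDerivAt_cross2 (hsub τ) (hasDerivAt_const τ (unitVec' φ))).congr_deriv ?_
          rw [(hs τ).1]
          simp [cross2]; ring)
        (fun τ => by
          refine (hasDerivAt_cross2 (hsub τ) (hasDerivAt_const τ (unitVec φ))).neg.congr_deriv ?_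
          rw [(hs τ).2]
          simp [cross2]; ring)
        (by
          simp only [q, cross2, PiLp.sub_apply] at hφ ⊢
          rw [zero_add, add_comm (2 * π)]
          linarith)
        (by
          simp only [cross2, PiLp.sub_apply] at hlt ⊢
          rw [zero_add, add_comm (2 * π)]
          linarith)
      have hceq : c (a + φ) = c (b + φ) := by
        have hs := Real.sin_sq_add_cos_sq φ
        simp only [cross2, unitVec_zero, unitVec_one, unitVec'_zero, unitVec'_one] at hx hh
        ext i
        fin_cases i
        · simp only [Fin.zero_eta]
          linear_combination Real.cos φ * hx - Real.sin φ * hh -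
            (c (a + φ) 0 - c (b + φ) 0) * hs
        · simp only [Fin.mk_one]
          linear_combination Real.sin φ * hx + Real.cos φ * hh -
            (c (a + φ) 1 - c (b + φ) 1) * hs
      obtain ⟨k, hk⟩ := hinj _ _ hceq
      have hkn : b - a = ((k * n : ℤ) : ℝ) * (2 * π) := by
        push_cast
        rw [mul_assoc, ← hn]
        linarith
      rw [hkn] at hab hab'
      have h1 : (0 : ℝ) < ((k * n : ℤ) : ℝ) := by
        by_contra! hle
        nlinarith
      have h2 : ((k * n : ℤ) : ℝ) < 1 := by
        by_contra! hle
        nlinarith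
      have h1' : 0 < k * n := by exact_mod_cast h1
      have h2' : k * n < 1 := by exact_mod_cast h2
      omega
  let p : ℝ → ℝ := fun φ => cross2 (c φ) (unitVec φ)
  have hp : Function.Periodic p P := by
    intro φ
    simp only [p, cross2, unitVec_zero, unitVec_one, hper φ]
    rw [hn, Real.cos_add_int_mul_two_pi, Real.sin_add_int_mul_two_pi]
  have cp : Continuous p := continuous_iff_continuousAt.2 fun t =>
    (hasDerivAt_cross2 (hc t) (hasDerivAt_unitVec t)).continuousAt
  have hqp : ∀ φ, q φ = p (φ + 2 * π) - p φ := by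
    intro φ
    simp only [q, p, cross2, unitVec_zero, unitVec_one, PiLp.sub_apply, Real.cos_add_two_pi,
      Real.sin_add_two_pi]
    ring
  have hqper : Function.Periodic q P := by
    intro φ
    rw [hqp, hqp, hp φ, add_right_comm, hp]
  obtain ⟨m, hm⟩ : ∃ m, ∀ φ, p φ ≤ p m := by
    obtain ⟨_, ⟨m, rfl⟩, hm⟩ := (hp.compact_of_continuous hP cp).exists_isGreatest
      (range_nonempty p)
    exact ⟨m, fun φ => hm (mem_range_self φ)⟩
  obtain ⟨z, hz⟩ : ∃ z, q z = 0 := by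
    have h1 : q m ≤ 0 := by rw [hqp]; linarith [hm (m + 2 * π)]
    have h2 : 0 ≤ q (m - 2 * π) := by
      rw [hqp, sub_add_cancel]; linarith [hm (m - 2 * π)]
    obtain ⟨z, -, hz⟩ := intermediate_value_Icc' (show m - 2 * π ≤ m by linarith)
      cq.continuousOn ⟨h1, h2⟩
    exact ⟨z, hz⟩
  have hright : ∀ φ, z ≤ φ → q φ ≤ 0 := fun φ hφ =>
    image_le_of_deriv_right_lt_deriv_boundary (B := fun _ => 0) (B' := fun _ => 0)
      cq.continuousOn (fun x _ => (hq x).hasDerivWithinAt) hz.le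
      (fun x => hasDerivAt_const x 0) (fun x _ hx => hneg x hx) ⟨hφ, le_rfl⟩
  have hle : ∀ φ, q φ ≤ 0 := by
    intro φ
    obtain ⟨y, hy, hyq⟩ : ∃ y, z ≤ y ∧ q y = q φ := by
      have habs : Function.Periodic q |P| := by
        rcases abs_choice P with h | h <;> rw [h]
        exacts [hqper, hqper.neg]
      obtain ⟨y, hy, hyq⟩ := habs.exists_mem_Ico (abs_pos.2 hP) φ z
      exact ⟨y, hy.1, hyq.symm⟩
    exact hyq ▸ hright y hy
  have hmax : IsLocalMax q z := Eventually.of_forall fun φ => by rw [hz]; exact hle φ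
  exact (hneg z hz).ne (hmax.hasDerivAt_eq_zero (hq z))

end Convexity

section AngleParametrization

lemma exists_continuous_inverse_of_deriv_pos {θ w : ℝ → ℝ} {P : ℝ}
    (hθ : ∀ s, HasDerivAt θ (w s) s) (hw : ∀ s, 0 < w s) (hP : ∀ s, θ (s + 1) = θ s + P) :
    ∃ S : ℝ → ℝ, Continuous S ∧ (∀ s, S (θ s) = s) ∧ ∀ φ, θ (S φ) = φ := by
  have hmono : StrictMono θ := strictMono_of_deriv_pos fun s => by rw [(hθ s).deriv]; exact hw s
  have hcont : Continuous θ := continuous_iff_continuousAt.2 fun t => (hθ t).continuousAt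
  have hPpos : 0 < P := by linarith [hP 0, hmono (show (0 : ℝ) < 0 + 1 by norm_num)]
  have hper : Function.Periodic (fun s => θ s - P * s) 1 := fun s => by
    simp only [hP]; ring
  have hθn : ∀ n : ℤ, θ n = θ 0 + P * n := fun n => by
    have h := hper.int_mul n 0
    simp only [mul_one, zero_add, mul_zero, sub_zero] at h
    linarith
  have hsurj : Function.Surjective θ := by
    intro φ
    refine mem_range_of_exists_le_of_exists_ge hcont ⟨⌊(φ - θ 0) / P⌋, ?_⟩ ⟨⌈(φ - θ 0) / P⌉, ?_⟩
    · have := (le_div_iff₀ hPpos).1 (Int.floor_le ((φ - θ 0) / P))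
      rw [hθn]; linarith
    · have := (div_le_iff₀ hPpos).1 (Int.le_ceil ((φ - θ 0) / P))
      rw [hθn]; linarith
  let I := hmono.orderIsoOfSurjective θ hsurj
  exact ⟨I.symm, I.toHomeomorph.symm.continuous, fun s => I.symm_apply_apply s,
    fun φ => I.apply_symm_apply φ⟩

lemma exists_continuous_inverse_of_deriv_ne_zero {θ w : ℝ → ℝ} {P : ℝ}
    (hθ : ∀ s, HasDerivAt θ (w s) s) (hwc : Continuous w) (hw : ∀ s, w s ≠ 0)
    (hP : ∀ s, θ (s + 1) = θ s + P) :
    ∃ S : ℝ → ℝ, Continuous S ∧ (∀ s, S (θ s) = s) ∧ ∀ φ, θ (S φ) = φ := by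
  by_cases hpos : ∀ s, 0 < w s
  · exact exists_continuous_inverse_of_deriv_pos hθ hpos hP
  · obtain ⟨s₀, hs₀⟩ := not_forall.1 hpos
    have hneg : ∀ s, 0 < -w s := by
      intro s
      by_contra hs
      obtain ⟨z, hz⟩ := mem_range_of_exists_le_of_exists_ge hwc ⟨s₀, not_lt.1 hs₀⟩
        ⟨s, by linarith⟩
      exact hw z hz
    obtain ⟨S, hS, h1, h2⟩ := exists_continuous_inverse_of_deriv_pos (θ := fun s => -θ s) (P := -P)
      (fun s => (hθ s).neg) hneg (fun s => by rw [hP]; ring)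
    exact ⟨fun φ => S (-φ), hS.comp continuous_neg, h1, fun φ => by linarith [h2 (-φ)]⟩

/-- The angle function obtained by integrating the rotation speed of a vector stays tangent to
it. -/
lemma cross2_unitVec_eq_zero_of_hasDerivAt {v v' : ℝ → E2} {θ : ℝ → ℝ}
    (hv : ∀ s, HasDerivAt v (v' s) s) (hv0 : ∀ s, v s 0 ^ 2 + v s 1 ^ 2 ≠ 0)
    (hθ : ∀ s, HasDerivAt θ (cross2 (v s) (v' s) / (v s 0 ^ 2 + v s 1 ^ 2)) s)
    (hinit : cross2 (unitVec (θ 0)) (v 0) = 0) (s : ℝ) : cross2 (unitVec (θ s)) (v s) = 0 := by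
  let B : ℝ → ℝ := fun s => cross2 (unitVec (θ s)) (v s) ^ 2 / (v s 0 ^ 2 + v s 1 ^ 2)
  have hB : ∀ s, HasDerivAt B 0 s := by
    intro s
    have hb := hasDerivAt_cross2 ((hasDerivAt_unitVec (θ s)).scomp s (hθ s)) (hv s)
    obtain ⟨v0, v1⟩ := hasDerivAt_E2_iff.1 (hv s)
    refine ((hb.pow 2).div ((v0.pow 2).add (v1.pow 2)) (hv0 s)).congr_deriv ?_
    have := hv0 s
    simp only [cross2, Function.comp_apply, PiLp.smul_apply, smul_eq_mul, unitVec_zero, unitVec_one,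
      unitVec'_zero, unitVec'_one, Pi.pow_apply, Pi.add_apply]
    field_simp
    ring
  have hconst := is_const_of_deriv_eq_zero (fun s => (hB s).differentiableAt)
    (fun s => (hB s).deriv) s 0
  simp only [B, hinit, ne_eq, OfNat.ofNat_ne_zero, not_false_eq_true, zero_pow, zero_div] at hconst
  exact pow_eq_zero_iff (two_ne_zero) |>.1 ((div_eq_zero_iff.1 hconst).resolve_right (hv0 s))

/-- A parametrization of a plane curve by its tangent angle. -/
structure AngleParam (M : PlaneCurve) where
  /-- the tangent angle -/
  θ : ℝ → ℝ
  /-- the speed of the tangent angle -/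
  w : ℝ → ℝ
  /-- the reparametrized curve -/
  c : ℝ → E2
  /-- the radius of curvature -/
  ρ : ℝ → ℝ
  /-- the total turning -/
  P : ℝ
  hasDerivAt_θ : ∀ s, HasDerivAt θ (w s) s
  w_ne_zero : ∀ s, w s ≠ 0
  γ_eq : ∀ s, M.γ s = c (θ s)
  hasDerivAt_c : ∀ φ, HasDerivAt c (ρ φ • unitVec φ) φ
  ρ_pos : ∀ φ, 0 < ρ φ
  contDiff_ρ : ContDiff ℝ 1 ρ
  P_ne_zero : P ≠ 0
  periodic_c : Function.Periodic c P
  exists_int_of_eq : ∀ a b, c a = c b → ∃ k : ℤ, b - a = k * P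

lemma E2_sq_add_sq_ne_zero {v : E2} (hv : v ≠ 0) : v 0 ^ 2 + v 1 ^ 2 ≠ 0 := by
  intro h
  apply hv
  have h0 : v 0 = 0 := by nlinarith [sq_nonneg (v 0), sq_nonneg (v 1)]
  have h1 : v 1 = 0 := by nlinarith [sq_nonneg (v 0), sq_nonneg (v 1)]
  ext i
  fin_cases i
  exacts [h0, h1]

/-- A nonzero vector is a multiple, of any prescribed sign, of a unit vector. -/
lemma exists_eq_smul_unitVec {v : E2} (hv : v ≠ 0) {σ : ℝ} (hσ : σ ≠ 0) :
    ∃ a α : ℝ, 0 < a * σ ∧ v = a • unitVec α := by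
  let z : ℂ := ⟨v 0, v 1⟩
  have hz : 0 < ‖z‖ := by
    rw [norm_pos_iff]
    intro h
    apply E2_sq_add_sq_ne_zero hv
    have h0 : v 0 = 0 := congrArg Complex.re h
    have h1 : v 1 = 0 := congrArg Complex.im h
    rw [h0, h1]; ring
  have h0 : v 0 = ‖z‖ * Real.cos z.arg := (Complex.norm_mul_cos_arg z).symm
  have h1 : v 1 = ‖z‖ * Real.sin z.arg := (Complex.norm_mul_sin_arg z).symm
  rcases hσ.lt_or_gt with h | h
  · refine ⟨-‖z‖, z.arg + π, by nlinarith, ?_⟩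
    ext i
    fin_cases i
    · simpa using h0
    · simpa using h1
  · refine ⟨‖z‖, z.arg, by positivity, ?_⟩
    ext i
    fin_cases i
    · simpa using h0
    · simpa using h1

lemma PlaneCurve.IsConvexCurve.nonempty_angleParam {M : PlaneCurve} (hM : M.IsConvexCurve) :
    Nonempty (AngleParam M) := by
  obtain ⟨hper, hinj, hcurv⟩ := hM
  set v := deriv M.γ with hvdef
  set v' := deriv v with hv'def
  have cv : ContDiff ℝ (⊤ : ℕ∞) v := (contDiff_infty_iff_deriv.1 M.smooth).2
  have cv' : ContDiff ℝ (⊤ : ℕ∞) v' := (contDiff_infty_iff_deriv.1 cv).2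
  have hγ : ∀ s, HasDerivAt M.γ (v s) s := fun s =>
    ((contDiff_infty_iff_deriv.1 M.smooth).1 s).hasDerivAt
  have hv : ∀ s, HasDerivAt v (v' s) s := fun s =>
    ((contDiff_infty_iff_deriv.1 cv).1 s).hasDerivAt
  have hN : ∀ s, v s 0 ^ 2 + v s 1 ^ 2 ≠ 0 := fun s => E2_sq_add_sq_ne_zero (M.regular s)
  have hcr : ∀ s, cross2 (v s) (v' s) ≠ 0 := fun s h => hcurv s (by
    rw [curvature, ← hvdef, ← hv'def, h, zero_div])
  let w : ℝ → ℝ := fun s => cross2 (v s) (v' s) / (v s 0 ^ 2 + v s 1 ^ 2)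
  have hw : ∀ s, w s ≠ 0 := fun s => div_ne_zero (hcr s) (hN s)
  have cvi : ∀ i, ContDiff ℝ 1 fun s => v s i := contDiff_euclidean.1 (cv.of_le (by simp))
  have cvi' : ∀ i, ContDiff ℝ 1 fun s => v' s i := contDiff_euclidean.1 (cv'.of_le (by simp))
  have cw : ContDiff ℝ 1 w :=
    (((cvi 0).mul (cvi' 1)).sub ((cvi 1).mul (cvi' 0))).div
      (((cvi 0).pow 2).add ((cvi 1).pow 2)) hN
  obtain ⟨a₀, α, ha₀, hα⟩ := exists_eq_smul_unitVec (M.regular 0) (hw 0)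
  let θ : ℝ → ℝ := fun s => α + ∫ t in (0 : ℝ)..s, w t
  have hθ : ∀ s, HasDerivAt θ (w s) s := fun s =>
    (cw.continuous.integral_hasStrictDerivAt 0 s).hasDerivAt.const_add α
  have hθ0 : θ 0 = α := by simp [θ]
  have cθ : ContDiff ℝ 1 θ := contDiff_one_iff_deriv.2
    ⟨fun s => (hθ s).differentiableAt, by
      rw [show deriv θ = w from funext fun s => (hθ s).deriv]; exact cw.continuous⟩
  have htan : ∀ s, cross2 (unitVec (θ s)) (v s) = 0 :=
    cross2_unitVec_eq_zero_of_hasDerivAt hv hN hθ (by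
      rw [hθ0, show v 0 = a₀ • unitVec α from hα, cross2_smul_right, cross2_self, mul_zero])
  let a : ℝ → ℝ := fun s => v s 0 * Real.cos (θ s) + v s 1 * Real.sin (θ s)
  have ca : ContDiff ℝ 1 a := ((cvi 0).mul cθ.cos).add ((cvi 1).mul cθ.sin)
  have hva : ∀ s, v s = a s • unitVec (θ s) := by
    intro s
    have h := htan s
    have hs := Real.sin_sq_add_cos_sq (θ s)
    simp only [cross2, unitVec_zero, unitVec_one] at h
    ext i
    fin_cases i
    · simp only [a, Fin.zero_eta, PiLp.smul_apply, smul_eq_mul, unitVec_zero]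
      linear_combination -Real.sin (θ s) * h - v s 0 * hs
    · simp only [a, Fin.mk_one, PiLp.smul_apply, smul_eq_mul, unitVec_one]
      linear_combination Real.cos (θ s) * h - v s 1 * hs
  have ha : ∀ s, a s ≠ 0 := fun s h => M.regular s (by rw [← hvdef, hva, h, zero_smul])
  have haw : ∀ s, 0 < a s * w s := by
    intro s
    by_contra hs
    have h0 : 0 < a 0 * w 0 := by
      have : a 0 = a₀ := by
        simp only [a, hθ0, hα, hvdef, PiLp.smul_apply, smul_eq_mul, unitVec_zero, unitVec_one]
        linear_combination a₀ * Real.sin_sq_add_cos_sq α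
      rwa [this]
    obtain ⟨z, hz⟩ := mem_range_of_exists_le_of_exists_ge (ca.continuous.mul cw.continuous)
      ⟨s, not_lt.1 hs⟩ ⟨0, h0.le⟩
    exact mul_ne_zero (ha z) (hw z) hz
  have hvper : ∀ s, v (s + 1) = v s := by
    intro s
    have h1 := (hγ (s + 1)).comp_add_const s 1
    rw [show (fun x => M.γ (x + 1)) = M.γ from funext hper] at h1
    exact h1.unique (hγ s)
  have hv'per : ∀ s, v' (s + 1) = v' s := by
    intro s
    have h1 := (hv (s + 1)).comp_add_const s 1
    rw [show (fun x => v (x + 1)) = v from funext hvper] at h1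
    exact h1.unique (hv s)
  have hwper : ∀ s, w (s + 1) = w s := fun s => by simp only [w, hvper, hv'per]
  set P := θ 1 - θ 0 with hPdef
  have hθP : ∀ s, θ (s + 1) = θ s + P := by
    intro s
    have hd : ∀ s, HasDerivAt (fun s => θ (s + 1) - θ s) 0 s := fun s => by
      have := ((hθ (s + 1)).comp_add_const s 1).sub (hθ s)
      rwa [hwper, sub_self] at this
    have := is_const_of_deriv_eq_zero (fun s => (hd s).differentiableAt)
      (fun s => (hd s).deriv) s 0
    simp only [zero_add] at this
    linarith
  obtain ⟨S, hS, hSθ, hθS⟩ := exists_continuous_inverse_of_deriv_ne_zero hθ cw.continuous hw hθP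
  have hSd : ∀ φ, HasDerivAt S (w (S φ))⁻¹ φ := fun φ =>
    HasDerivAt.of_local_left_inverse hS.continuousAt (hθ (S φ)) (hw _) (Eventually.of_forall hθS)
  have cS : ContDiff ℝ 1 S := contDiff_one_iff_deriv.2
    ⟨fun s => (hSd s).differentiableAt, by
      rw [show deriv S = fun φ => (w (S φ))⁻¹ from funext fun s => (hSd s).deriv]
      exact (cw.continuous.comp hS).inv₀ fun φ => hw _⟩
  have hθint : ∀ s (n : ℤ), θ (s + n) = θ s + n * P := by
    intro s n
    have hp : Function.Periodic (fun s => θ s - P * s) 1 := fun s => by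
      simp only [hθP]; ring
    have h := hp.int_mul n s
    simp only [mul_one] at h
    linarith
  refine ⟨⟨θ, w, fun φ => M.γ (S φ), fun φ => a (S φ) / w (S φ), P, hθ, hw,
    fun s => by rw [hSθ], fun φ => ?_, fun φ => ?_, ?_, ?_, ?_, ?_⟩⟩
  · refine ((hγ (S φ)).scomp φ (hSd φ)).congr_deriv ?_
    rw [hva, hθS, smul_smul, div_eq_inv_mul]
  · exact div_pos_iff.2 ((mul_pos_iff).1 (haw (S φ)))
  · exact (ca.comp cS).div (cw.comp cS) fun φ => hw _
  · intro h
    have := congrArg S (sub_eq_zero.1 (hPdef ▸ h))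
    rw [hSθ, hSθ] at this
    exact one_ne_zero this
  · intro φ
    have : S (φ + P) = S φ + 1 := by
      rw [← hSθ (S φ + 1), hθP, hθS]
    simp only [this, hper (S φ)]
  · intro x y hxy
    have hfr : ∀ s, M.γ (Int.fract s) = M.γ s := fun s => by
      have := hper.sub_int_mul_eq ⌊s⌋ (x := s)
      rwa [mul_one] at this
    have heq := hinj ⟨Int.fract_nonneg (S x), Int.fract_lt_one _⟩
      ⟨Int.fract_nonneg (S y), Int.fract_lt_one _⟩ (by rw [hfr, hfr]; exact hxy)
    obtain ⟨k, hk⟩ := Int.fract_eq_fract.1 heq.symm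
    refine ⟨k, ?_⟩
    have := hθint (S x) k
    rw [show S x + k = S y by linarith, hθS, hθS] at this
    linarith

end AngleParametrization

section Inflexion

lemma not_isInflexionPoint_of_mem_fronts {E : Set E2} {ι : Type*} [Countable ι]
    {g e e' : ι → ℝ → E2} {ρ : ι → ℝ → ℝ} {c : ℝ} (hc : 0 < c)
    (hg : ∀ i φ, HasDerivAt (g i) (ρ i φ • e i φ) φ)
    (he : ∀ i φ, HasDerivAt (e i) (e' i φ) φ) (hcross : ∀ i φ, cross2 (e i φ) (e' i φ) ≠ 0)
    (hbound : ∀ i φ, c * (|ρ i φ| * ‖e i φ‖ ^ 3) ≤ |cross2 (e i φ) (e' i φ)|)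
    (hE : ∀ x ∈ E, ∃ i φ, x = g i φ) (p : E2) : ¬ IsInflexionPoint E p := by
  rintro ⟨-, f, t₀, hf, -, h0, ⟨U, -, ε, hε, hU⟩, hcurv⟩
  obtain ⟨df, hf'⟩ := contDiff_infty_iff_deriv.1 hf
  obtain ⟨df', hf''⟩ := contDiff_infty_iff_deriv.1 hf'
  have hmem : ∀ᶠ t in 𝓝 t₀, ∃ i φ, f t = g i φ := by
    filter_upwards [Ioo_mem_nhds (sub_lt_self t₀ hε) (lt_add_of_pos_right t₀ hε)] with t ht
    exact hE _ (hU.symm.subset (mem_image_of_mem f ht)).1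
  refine cross2_ne_zero_of_mem_fronts hc hg he hcross hbound (fun t => (df t).hasDerivAt)
    (fun t => (df' t).hasDerivAt) hf''.continuous h0 hmem ?_
  exact (div_eq_zero_iff.1 hcurv).resolve_right (pow_ne_zero 3 (norm_ne_zero_iff.2 h0))

lemma exists_forall_abs_le_of_periodic {f : ℝ → ℝ} {P : ℝ} (hf : Continuous f) (hP : P ≠ 0)
    (hper : Function.Periodic f P) : ∃ B, 0 ≤ B ∧ ∀ x, |f x| ≤ B := by
  obtain ⟨B, hB⟩ := isBounded_iff_forall_norm_le.1 (hper.isBounded_of_continuous hP hf)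
  exact ⟨B, (norm_nonneg _).trans (hB _ (mem_range_self 0)), fun x => hB _ (mem_range_self x)⟩

lemma hasDerivAt_comp_add_const {c : ℝ → E2} {ρ : ℝ → ℝ}
    (hc : ∀ φ, HasDerivAt c (ρ φ • unitVec φ) φ) (k : ℤ) (φ : ℝ) :
    HasDerivAt (fun φ => c (φ + k * π))
      ((Real.cos (k * π) * ρ (φ + k * π)) • unitVec φ) φ := by
  refine ((hc (φ + k * π)).comp_add_const φ (k * π)).congr_deriv ?_
  rw [unitVec_add_int_mul_pi, smul_smul, mul_comm]

lemma surjective_of_cross2_ne_zero {L : ℝ × ℝ →L[ℝ] E2}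
    (h : cross2 (L (1, 0)) (L (0, 1)) ≠ 0) : Function.Surjective L := by
  intro v
  refine ⟨(cross2 v (L (0, 1)) / cross2 (L (1, 0)) (L (0, 1)),
    cross2 (L (1, 0)) v / cross2 (L (1, 0)) (L (0, 1))), ?_⟩
  have hL : ∀ x y : ℝ, L (x, y) = x • L (1, 0) + y • L (0, 1) := fun x y => by
    rw [← map_smul, ← map_smul, ← map_add]
    simp
  rw [hL]
  ext i
  fin_cases i
  · simp only [Fin.zero_eta, PiLp.add_apply, PiLp.smul_apply, smul_eq_mul]
    field_simp
    simp only [cross2]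
    ring
  · simp only [Fin.mk_one, PiLp.add_apply, PiLp.smul_apply, smul_eq_mul]
    field_simp
    simp only [cross2]
    ring

end Inflexion

namespace AngleParam

variable {M : PlaneCurve} (A : AngleParam M)
include A

lemma periodic_c_two_pi : Function.Periodic A.c (2 * π) :=
  periodic_two_pi_of_simple A.ρ_pos A.hasDerivAt_c A.P_ne_zero A.periodic_c A.exists_int_of_eq

lemma periodic_ρ_two_pi : Function.Periodic A.ρ (2 * π) := by
  intro φ
  have h := hasDerivAt_comp_add_const A.hasDerivAt_c 2 φ
  simp only [Int.cast_ofNat, Real.cos_two_pi, one_mul] at h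
  rw [show (fun φ => A.c (φ + 2 * π)) = A.c from funext A.periodic_c_two_pi] at h
  have hne : unitVec φ ≠ 0 := norm_ne_zero_iff.1 (by rw [norm_unitVec]; exact one_ne_zero)
  exact smul_left_injective ℝ hne (h.unique (A.hasDerivAt_c φ))

lemma hasDerivAt_γ (s : ℝ) : HasDerivAt M.γ ((A.w s * A.ρ (A.θ s)) • unitVec (A.θ s)) s := by
  rw [show M.γ = A.c ∘ A.θ from funext A.γ_eq, ← smul_smul]
  exact (A.hasDerivAt_c (A.θ s)).scomp s (A.hasDerivAt_θ s)

lemma sin_eq_zero_of_vParallel {s t : ℝ} (h : VParallel (deriv M.γ s) (deriv M.γ t)) :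
    Real.sin (A.θ t - A.θ s) = 0 := by
  rw [VParallel, (A.hasDerivAt_γ s).deriv, (A.hasDerivAt_γ t).deriv, cross2_smul_left,
    cross2_smul_right, cross2_unitVec] at h
  have hne : ∀ s, A.w s * A.ρ (A.θ s) ≠ 0 := fun s =>
    mul_ne_zero (A.w_ne_zero s) (A.ρ_pos _).ne'
  exact ((mul_eq_zero.1 h).resolve_left (hne s) |> mul_eq_zero.1).resolve_left (hne t)

lemma exists_int_of_vParallel {s t : ℝ} (h : VParallel (deriv M.γ s) (deriv M.γ t)) :
    ∃ k : ℤ, A.θ t = A.θ s + k * π := by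
  obtain ⟨k, hk⟩ := Real.sin_eq_zero_iff.1 (A.sin_eq_zero_of_vParallel h)
  exact ⟨k, by linarith⟩

/-- The two points of a parallel pair have opposite directions. -/
lemma exists_int_of_parallelParams {s t : ℝ} (h : ParallelParams M s t) :
    ∃ k : ℤ, A.θ t = A.θ s + π + k * (2 * π) := by
  obtain ⟨k, hk⟩ := A.exists_int_of_vParallel h.2
  rcases Int.even_or_odd' k with ⟨m, rfl | rfl⟩
  · refine absurd ?_ h.1
    rw [A.γ_eq, A.γ_eq, hk]
    push_cast
    rw [show 2 * (m : ℝ) * π = m * (2 * π) by ring, A.periodic_c_two_pi.int_mul m]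
  · refine ⟨m, hk.trans ?_⟩
    push_cast
    ring

lemma not_isInflexionPoint_eqd (lam : ℝ) (p : E2) : ¬ IsInflexionPoint (Eqd M lam) p := by
  obtain ⟨B, hB0, hB⟩ := exists_forall_abs_le_of_periodic A.contDiff_ρ.continuous
    Real.two_pi_pos.ne' A.periodic_ρ_two_pi
  refine not_isInflexionPoint_of_mem_fronts (ι := ℤ) (c := (|lam| * B + |1 - lam| * B + 1)⁻¹)
    (g := fun k φ => lam • A.c φ + (1 - lam) • A.c (φ + k * π))
    (ρ := fun k φ => lam * A.ρ φ + (1 - lam) * (Real.cos (k * π) * A.ρ (φ + k * π)))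
    (e := fun _ => unitVec) (e' := fun _ => unitVec') (by positivity) (fun k φ => ?_)
    (fun _ φ => hasDerivAt_unitVec φ)
    (fun _ φ => by rw [cross2_unitVec_unitVec']; exact one_ne_zero) (fun k φ => ?_) ?_ p
  · refine (((A.hasDerivAt_c φ).const_smul lam).add
      ((hasDerivAt_comp_add_const A.hasDerivAt_c k φ).const_smul (1 - lam))).congr_deriv ?_
    rw [smul_smul, smul_smul, ← add_smul]
  · rw [norm_unitVec, one_pow, mul_one, cross2_unitVec_unitVec', abs_one,
      inv_mul_le_one₀ (by positivity)]
    have h : |Real.cos (k * π) * A.ρ (φ + k * π)| ≤ B := by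
      rw [abs_mul]
      exact (mul_le_of_le_one_left (abs_nonneg _) (Real.abs_cos_le_one _)).trans (hB _)
    calc _ ≤ |lam * A.ρ φ| + |(1 - lam) * (Real.cos (k * π) * A.ρ (φ + k * π))| := abs_add_le _ _
      _ ≤ |lam| * B + |1 - lam| * B := by
          rw [abs_mul, abs_mul (1 - lam)]
          gcongr
          exact hB φ
      _ ≤ _ := by linarith
  · rintro x ⟨a, b, ⟨s, t, rfl, rfl, -, hpar⟩, rfl⟩
    obtain ⟨k, hk⟩ := A.exists_int_of_vParallel hpar
    exact ⟨k, A.θ s, by rw [A.γ_eq, A.γ_eq, hk]⟩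

/-- The oriented distance from a point of the curve to the antipodal tangent line. -/
lemma cross2_unitVec_chord_pos (φ : ℝ) : 0 < cross2 (unitVec φ) (A.c (φ + π) - A.c φ) := by
  have hd : ∀ ψ, HasDerivAt (fun ψ => cross2 (unitVec φ) (A.c ψ - A.c φ))
      (A.ρ ψ * Real.sin (ψ - φ)) ψ := fun ψ => by
    refine (hasDerivAt_cross2 (hasDerivAt_const ψ (unitVec φ))
      ((A.hasDerivAt_c ψ).sub_const (A.c φ))).congr_deriv ?_
    rw [cross2_smul_right, cross2_unitVec]
    simp [cross2]
  have hmono : StrictMonoOn (fun ψ => cross2 (unitVec φ) (A.c ψ - A.c φ)) (Icc φ (φ + π)) := by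
    refine strictMonoOn_of_deriv_pos (convex_Icc _ _)
      (fun ψ _ => (hd ψ).continuousAt.continuousWithinAt) fun ψ hψ => ?_
    rw [interior_Icc] at hψ
    rw [(hd ψ).deriv]
    exact mul_pos (A.ρ_pos ψ) (Real.sin_pos_of_pos_of_lt_pi (by linarith [hψ.1])
      (by linarith [hψ.2]))
  have hle : φ ≤ φ + π := by linarith [Real.pi_pos]
  have h := hmono (left_mem_Icc.2 hle) (right_mem_Icc.2 hle) (by linarith [Real.pi_pos])
  simpa [cross2] using h

lemma hasDerivAt_chord (φ : ℝ) : HasDerivAt (fun φ => A.c (φ + π) - A.c φ)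
    (-(A.ρ φ + A.ρ (φ + π)) • unitVec φ) φ := by
  have h := hasDerivAt_comp_add_const A.hasDerivAt_c 1 φ
  simp only [Int.cast_one, one_mul, Real.cos_pi] at h
  refine (h.sub (A.hasDerivAt_c φ)).congr_deriv ?_
  rw [← sub_smul]
  ring_nf

lemma mem_css {x : E2} (hx : x ∈ CSS M) :
    ∃ φ, x = A.c φ + (A.ρ φ / (A.ρ φ + A.ρ (φ + π))) • (A.c (φ + π) - A.c φ) := by
  obtain ⟨T, hT, hpar, ⟨s, u⟩, rfl, hsurj⟩ := hx
  have hTd : HasDerivAt T (deriv T s) s := ((contDiff_infty_iff_deriv.1 hT).1 s).hasDerivAt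
  obtain ⟨k, hk⟩ := A.exists_int_of_parallelParams (hpar s)
  have hcT : M.γ (T s) = A.c (A.θ s + π) := by
    rw [A.γ_eq, hk, A.periodic_c_two_pi.int_mul k]
  have hρT : A.ρ (A.θ (T s)) = A.ρ (A.θ s + π) := by
    rw [hk, A.periodic_ρ_two_pi.int_mul k]
  have huT : unitVec (A.θ (T s)) = -unitVec (A.θ s) := by
    rw [hk]
    ext i
    fin_cases i <;> simp
  have hwT : deriv T s * A.w (T s) = A.w s := by
    have h := (((A.hasDerivAt_θ (T s)).comp s hTd).sub (A.hasDerivAt_θ s)).sin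
    have h0 : (fun s => Real.sin ((A.θ ∘ T - A.θ) s)) = fun _ => 0 :=
      funext fun s => A.sin_eq_zero_of_vParallel (hpar s).2
    rw [h0] at h
    have h1 := h.unique (hasDerivAt_const s (0 : ℝ))
    have hcos : Real.cos ((A.θ ∘ T - A.θ) s) = -1 := by
      simp only [Pi.sub_apply, Function.comp_apply, hk]
      rw [show A.θ s + π + k * (2 * π) - A.θ s = π + k * (2 * π) by ring,
        Real.cos_add_int_mul_two_pi, Real.cos_pi]
    rw [hcos] at h1
    linarith
  have hγ := A.hasDerivAt_γ s
  have hγT : HasDerivAt (fun s => M.γ (T s)) (-(A.w s * A.ρ (A.θ s + π)) • unitVec (A.θ s)) s := by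
    refine ((A.hasDerivAt_γ (T s)).scomp s hTd).congr_deriv ?_
    rw [huT, hρT, ← hwT, smul_smul, smul_neg, neg_smul, mul_assoc]
  have hdiff : DifferentiableAt ℝ (chordFamily M T) (s, u) := by
    have h1 : DifferentiableAt ℝ (fun q : ℝ × ℝ => M.γ q.1) (s, u) :=
      DifferentiableAt.comp (s, u) (g := M.γ) hγ.differentiableAt differentiableAt_fst
    have h2 : DifferentiableAt ℝ (fun q : ℝ × ℝ => M.γ (T q.1)) (s, u) :=
      DifferentiableAt.comp (s, u) (g := fun s => M.γ (T s)) hγT.differentiableAt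
        differentiableAt_fst
    exact h1.add (differentiableAt_snd.smul (h2.sub h1))
  have hL1 : fderiv ℝ (chordFamily M T) (s, u) (1, 0) =
      (A.w s * ((1 - u) * A.ρ (A.θ s) - u * A.ρ (A.θ s + π))) • unitVec (A.θ s) := by
    have h := hdiff.hasFDerivAt.comp_hasDerivAt s
      ((hasDerivAt_id s).prodMk (hasDerivAt_const s u))
    refine h.unique ((hγ.add ((hγT.sub hγ).const_smul u)).congr_deriv ?_)
    rw [← sub_smul, smul_smul, ← add_smul]
    ring_nf
  have hL2 : fderiv ℝ (chordFamily M T) (s, u) (0, 1) = A.c (A.θ s + π) - A.c (A.θ s) := by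
    have h := hdiff.hasFDerivAt.comp_hasDerivAt u
      ((hasDerivAt_const u s).prodMk (hasDerivAt_id u))
    rw [← hcT, ← A.γ_eq]
    refine h.unique ((((hasDerivAt_id u).smul_const (M.γ (T s) - M.γ s)).const_add
      (M.γ s)).congr_deriv ?_)
    rw [one_smul]
  have hzero : cross2 (fderiv ℝ (chordFamily M T) (s, u) (1, 0))
      (fderiv ℝ (chordFamily M T) (s, u) (0, 1)) = 0 := by
    by_contra h
    exact hsurj (surjective_of_cross2_ne_zero h)
  rw [hL1, hL2, cross2_smul_left] at hzero
  have h := ((mul_eq_zero.1 hzero).resolve_right (A.cross2_unitVec_chord_pos _).ne' |>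
    mul_eq_zero.1).resolve_left (A.w_ne_zero s)
  have hu : u = A.ρ (A.θ s) / (A.ρ (A.θ s) + A.ρ (A.θ s + π)) := by
    rw [eq_div_iff (add_pos (A.ρ_pos _) (A.ρ_pos _)).ne']
    linarith
  refine ⟨A.θ s, ?_⟩
  rw [← hu, chordFamily, hcT, A.γ_eq]

lemma not_isInflexionPoint_css (p : E2) : ¬ IsInflexionPoint (CSS M) p := by
  have hsum : ∀ φ, 0 < A.ρ φ + A.ρ (φ + π) := fun φ => add_pos (A.ρ_pos _) (A.ρ_pos _)
  obtain ⟨dρ, hρ'⟩ := contDiff_one_iff_deriv.1 A.contDiff_ρ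
  let u : ℝ → ℝ := fun φ => A.ρ φ / (A.ρ φ + A.ρ (φ + π))
  let e : ℝ → E2 := fun φ => A.c (φ + π) - A.c φ
  let e' : ℝ → E2 := fun φ => -(A.ρ φ + A.ρ (φ + π)) • unitVec φ
  have cu : ContDiff ℝ 1 u := A.contDiff_ρ.div (A.contDiff_ρ.add
    (A.contDiff_ρ.comp (contDiff_id.add contDiff_const))) fun φ => (hsum φ).ne'
  obtain ⟨du, cu'⟩ := contDiff_one_iff_deriv.1 cu
  have hcross : ∀ φ, cross2 (e φ) (e' φ) ≠ 0 := fun φ => by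
    rw [cross2_smul_right, cross2_swap]
    exact mul_ne_zero (neg_ne_zero.2 (hsum φ).ne')
      (neg_ne_zero.2 (A.cross2_unitVec_chord_pos φ).ne')
  have hρπ : ∀ φ, A.ρ (φ + 2 * π + π) = A.ρ (φ + π) := fun φ => by
    rw [add_right_comm, A.periodic_ρ_two_pi]
  have hup : Function.Periodic u (2 * π) := fun φ => by
    simp only [u, hρπ, A.periodic_ρ_two_pi φ]
  have hup' : Function.Periodic (deriv u) (2 * π) := fun φ => by
    rw [← deriv_comp_add_const, show (fun x => u (x + 2 * π)) = u from funext hup]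
  have hep : Function.Periodic e (2 * π) := fun φ => by
    simp only [e, add_right_comm φ (2 * π) π, A.periodic_c_two_pi (φ + π), A.periodic_c_two_pi φ]
  have hep' : Function.Periodic e' (2 * π) := fun φ => by
    have : unitVec (φ + 2 * π) = unitVec φ := by
      ext i
      fin_cases i <;> simp
    simp only [e', hρπ, A.periodic_ρ_two_pi φ, this]
  have cc : Continuous A.c := continuous_iff_continuousAt.2 fun φ => (A.hasDerivAt_c φ).continuousAt
  have ce : Continuous e := (cc.comp (continuous_id.add continuous_const)).sub cc
  have cρ := A.contDiff_ρ.continuous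
  have ce' : Continuous e' :=
    (cρ.add (cρ.comp (continuous_id.add continuous_const))).neg.smul
      (continuous_iff_continuousAt.2 fun φ => (hasDerivAt_unitVec φ).continuousAt)
  obtain ⟨B, hB0, hB⟩ := exists_forall_abs_le_of_periodic
    (f := fun φ => deriv u φ * ‖e φ‖ ^ 3 / cross2 (e φ) (e' φ)) (P := 2 * π)
    ((cu'.mul (ce.norm.pow 3)).div (continuous_cross2.comp (ce.prodMk ce')) hcross)
    Real.two_pi_pos.ne' (fun φ => by simp only [hup' φ, hep φ, hep' φ])
  refine not_isInflexionPoint_of_mem_fronts (ι := Unit) (c := (B + 1)⁻¹)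
    (g := fun _ φ => A.c φ + u φ • e φ) (ρ := fun _ => deriv u) (e := fun _ => e)
    (e' := fun _ => e') (by positivity) (fun _ φ => ?_) (fun _ φ => A.hasDerivAt_chord φ)
    (fun _ => hcross) (fun _ φ => ?_) (fun x hx => ⟨(), A.mem_css hx⟩) p
  · refine ((A.hasDerivAt_c φ).add ((du φ).hasDerivAt.smul (A.hasDerivAt_chord φ))).congr_deriv ?_
    have hue : u φ * -(A.ρ φ + A.ρ (φ + π)) = -A.ρ φ := by
      simp only [u]
      have := (hsum φ).ne'
      field_simp
    rw [smul_smul, hue, neg_smul]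
    abel
  · have h := hB φ
    have hpos := abs_pos.2 (hcross φ)
    rw [abs_div, div_le_iff₀ hpos, abs_mul, abs_of_nonneg (pow_nonneg (norm_nonneg _) 3)] at h
    rw [inv_mul_le_iff₀ (by positivity)]
    linarith

end AngleParam

/-- If `M` is a convex curve, then for every `λ ∈ ℝ` the affine
`λ`-equidistant `E_λ(M)` has no inflexion points, and `CSS(M)` has no inflexion points. -/
theorem no_inflexion_points_of_convex
    (M : PlaneCurve) (hM : M.IsConvexCurve) :
    (∀ lam : ℝ, ∀ p : E2, ¬ IsInflexionPoint (Eqd M lam) p) ∧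
    (∀ p : E2, ¬ IsInflexionPoint (CSS M) p) := by
  obtain ⟨A⟩ := hM.nonempty_angleParam
  exact ⟨A.not_isInflexionPoint_eqd, A.not_isInflexionPoint_css⟩
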